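/- arXiv:2005.11095 — 3 statements merged into one kernel-verified Lean document; each statement's English description precedes it below -/
import Mathlib

section
/- Let S = {−x_1, −x_2, −x_3, ...} with x_1 < x_2 < x_3 < ⋯. Define S_1 = S and, for each i ≥ 1, S_{i+1} = S_i \ {−x_i} if (S_i \ {−x_i}) + 𝒯 = ℤ, and S_{i+1} = S_i otherwise; let 𝒮 = ⋂_{i≥1} S_i. Then (𝒮, 𝒯) is a co-minimal pair in ℤ. -/
open scoped Pointwise

/-- Nonempty subsets `A`, `B` of an abelian group `G` form a *co-minimal pair* if
`A + B = G`, no nonempty proper subset of `A` is an additive complement of `B`,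
and no nonempty proper subset of `B` is an additive complement of `A`. -/
def IsCoMinimalPair {G : Type*} [AddCommGroup G] (A B : Set G) : Prop :=
  A.Nonempty ∧ B.Nonempty ∧ A + B = Set.univ ∧
    (∀ A' : Set G, A'.Nonempty → A' ⊂ A → A' + B ≠ Set.univ) ∧
    (∀ B' : Set G, B'.Nonempty → B' ⊂ B → A + B' ≠ Set.univ)

/-- `𝒯 = {1, 2, 4, 8, ...}`, the powers of two. -/
def Tset : Set ℤ := {x | ∃ n : ℕ, x = 2 ^ n}

/-- `J_0 = J_1 = {1}`, `J_n = {1, ..., 2^(n-2)} ∪ (2^(n-1) + J_(n-1))` for `n ≥ 2`. -/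
def Jset : ℕ → Set ℤ
  | 0 => {1}
  | 1 => {1}
  | n + 2 => Set.Icc (1 : ℤ) (2 ^ n) ∪ (fun x => 2 ^ (n + 1) + x) '' Jset (n + 1)

/-- `K_0 = J_0`, `K_1 = J_1`, `K_2 = J_2 \ {1}`, and
`K_n = {2^(n-3)+1, ..., 2^(n-2)} ∪ (2^(n-1) + 2^(n-2) + J_(n-2))` for `n ≥ 3`. -/
def Kset : ℕ → Set ℤ
  | 0 => Jset 0
  | 1 => Jset 1
  | 2 => Jset 2 \ {1}
  | n + 3 => Set.Icc ((2 : ℤ) ^ n + 1) (2 ^ (n + 1)) ∪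
      (fun x => 2 ^ (n + 2) + 2 ^ (n + 1) + x) '' Jset (n + 1)

/-- `I_n = K_n − (1 + 2^(n+1))`. -/
def Iset (n : ℕ) : Set ℤ := (fun x => x - (1 + 2 ^ (n + 1))) '' Kset n

/-- `S = ⋃_{n ≥ 0} I_n`. -/
def Sset : Set ℤ := ⋃ n, Iset n

/-- Two powers of two are equal, or one is at least twice the other. -/
theorem Tset_trichotomy {p q : ℤ} (hp : p ∈ Tset) (hq : q ∈ Tset) :
    2 * p ≤ q ∨ p = q ∨ 2 * q ≤ p := by
  obtain ⟨m, rfl⟩ := hp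
  obtain ⟨n, rfl⟩ := hq
  rcases lt_trichotomy m n with h | h | h
  · left
    rw [← pow_succ']
    exact pow_le_pow_right₀ (by norm_num) h
  · exact Or.inr (Or.inl (by rw [h]))
  · right; right
    rw [← pow_succ']
    exact pow_le_pow_right₀ (by norm_num) h

theorem one_le_of_mem_Tset {p : ℤ} (hp : p ∈ Tset) : 1 ≤ p := by
  obtain ⟨n, rfl⟩ := hp
  exact one_le_pow₀ (by norm_num)

theorem two_mul_mem_Tset {p : ℤ} (hp : p ∈ Tset) : 2 * p ∈ Tset := by
  obtain ⟨n, rfl⟩ := hp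
  exact ⟨n + 1, by ring⟩

theorem half_mem_Tset {p : ℤ} (hp : p ∈ Tset) (h : 2 ≤ p) : ∃ q ∈ Tset, p = 2 * q := by
  obtain ⟨n, rfl⟩ := hp
  cases n with
  | zero => norm_num at h
  | succ n => exact ⟨2 ^ n, ⟨n, rfl⟩, by ring⟩

theorem exists_Tset_Ioc {y : ℤ} (hy : 1 ≤ y) : ∃ B ∈ Tset, B < 2 * y ∧ y ≤ B := by
  induction y, hy using Int.leInduction with
  | base => exact ⟨1, ⟨0, by norm_num⟩, by norm_num, by norm_num⟩
  | succ y hy ih =>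
    obtain ⟨B, hB, h1, h2⟩ := ih
    rcases lt_or_ge y B with h | h
    · exact ⟨B, hB, by omega, by omega⟩
    · exact ⟨2 * B, two_mul_mem_Tset hB, by omega, by omega⟩

/-- `y` lies in the upper quarter `(3B/4, B]` of the integers up to some power of two `B ≥ 2`. -/
def InUpperQuarter (y : ℤ) : Prop := ∃ B ∈ Tset, 2 ≤ B ∧ 3 * B < 4 * y ∧ y ≤ B

theorem inUpperQuarter_le_two_mul {y N : ℤ} (hN : N ∈ Tset) :
    InUpperQuarter y ∧ y ≤ 4 * N ↔
      (3 * N < y ∧ y ≤ 4 * N) ∨ (InUpperQuarter y ∧ y ≤ 2 * N) := by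
  have hN4 := two_mul_mem_Tset (two_mul_mem_Tset hN)
  have hN1 := one_le_of_mem_Tset hN
  constructor
  · rintro ⟨⟨B, hB, h2, h3, h4⟩, h5⟩
    rcases Tset_trichotomy hB hN4 with h | h | h
    · exact Or.inr ⟨⟨B, hB, h2, h3, h4⟩, by omega⟩
    · exact Or.inl ⟨by omega, by omega⟩
    · omega
  · rintro (⟨h1, h2⟩ | ⟨h1, h2⟩)
    · exact ⟨⟨_, hN4, by omega, by omega, by omega⟩, h2⟩
    · exact ⟨h1, by omega⟩

theorem mem_Jset_succ_iff (n : ℕ) (a : ℤ) :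
    a ∈ Jset (n + 1) ↔
      InUpperQuarter (2 ^ (n + 1) + 1 - a) ∧ 2 ^ (n + 1) + 1 - a ≤ 2 ^ (n + 1) := by
  induction n generalizing a with
  | zero =>
    simp only [Jset, Set.mem_singleton_iff]
    constructor
    · rintro rfl
      exact ⟨⟨2, ⟨1, by norm_num⟩, by norm_num, by norm_num, by norm_num⟩, by norm_num⟩
    · rintro ⟨⟨B, hB, h2, h3, h4⟩, h5⟩
      norm_num at h3 h4 h5
      omega
  | succ n ih =>
    have key := inUpperQuarter_le_two_mul (y := 2 ^ (n + 2) + 1 - a) (N := 2 ^ n) ⟨n, rfl⟩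
    have e2 : (2 : ℤ) ^ (n + 2) = 4 * 2 ^ n := by ring
    have e1 : (2 : ℤ) ^ (n + 1) = 2 * 2 ^ n := by ring
    have hJ : a ∈ Jset (n + 2) ↔ (1 ≤ a ∧ a ≤ 2 ^ n) ∨ a - 2 ^ (n + 1) ∈ Jset (n + 1) := by
      simp only [Jset, Set.mem_union, Set.mem_Icc, Set.mem_image]
      refine or_congr Iff.rfl ⟨?_, fun h => ⟨_, h, by ring⟩⟩
      rintro ⟨x, hx, rfl⟩
      simpa using hx
    rw [show n + 1 + 1 = n + 2 from rfl, hJ, ih]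
    rw [e2] at key ⊢
    rw [key, e1, show (2 : ℤ) * 2 ^ n + 1 - (a - 2 * 2 ^ n) = 4 * 2 ^ n + 1 - a by ring]
    refine or_congr ?_ Iff.rfl
    omega

/-- An explicit description of `-S` in terms of its dyadic blocks. -/
def InNegSset (x : ℤ) : Prop :=
  x = 2 ∨ x = 4 ∨ x = 6 ∨ ∃ N ∈ Tset, 8 ≤ N ∧
    ((InUpperQuarter (x - N) ∧ 4 * (x - N) ≤ N) ∨ (6 * N < 8 * (x - N) ∧ 8 * (x - N) ≤ 7 * N))

theorem mem_Iset_add_three_iff (n : ℕ) (s : ℤ) :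
    s ∈ Iset (n + 3) ↔
      (InUpperQuarter (-s - 2 ^ (n + 3)) ∧ 4 * (-s - 2 ^ (n + 3)) ≤ 2 ^ (n + 3)) ∨
      (6 * 2 ^ (n + 3) < 8 * (-s - 2 ^ (n + 3)) ∧ 8 * (-s - 2 ^ (n + 3)) ≤ 7 * 2 ^ (n + 3)) := by
  have hI : s ∈ Iset (n + 3) ↔
      (2 ^ n + 1 ≤ s + (1 + 2 ^ (n + 4)) ∧ s + (1 + 2 ^ (n + 4)) ≤ 2 ^ (n + 1)) ∨
      s + (1 + 2 ^ (n + 4)) - (2 ^ (n + 2) + 2 ^ (n + 1)) ∈ Jset (n + 1) := by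
    simp only [Iset, Kset, Set.mem_union, Set.mem_Icc, Set.mem_image]
    constructor
    · rintro ⟨k, h | ⟨j, hj, rfl⟩, rfl⟩
      · left; simpa using h
      · right; simpa using hj
    · rintro (h | h)
      · exact ⟨_, Or.inl h, by ring⟩
      · exact ⟨_, Or.inr ⟨_, h, rfl⟩, by ring⟩
  rw [hI, mem_Jset_succ_iff]
  have e1 : (2 : ℤ) ^ (n + 1) = 2 * 2 ^ n := by ring
  have e2 : (2 : ℤ) ^ (n + 2) = 4 * 2 ^ n := by ring
  have e3 : (2 : ℤ) ^ (n + 3) = 8 * 2 ^ n := by ring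
  have e4 : (2 : ℤ) ^ (n + 4) = 16 * 2 ^ n := by ring
  rw [e1, e2, e3, e4, or_comm]
  rw [show 2 * (2 : ℤ) ^ n + 1 - (s + (1 + 16 * 2 ^ n) - (4 * 2 ^ n + 2 * 2 ^ n))
    = -s - 8 * 2 ^ n by ring]
  refine or_congr (and_congr Iff.rfl ?_) ?_ <;> omega

theorem mem_Sset_iff (s : ℤ) : s ∈ Sset ↔ InNegSset (-s) := by
  have h0 : s ∈ Iset 0 ↔ -s = 2 := by
    simp only [Iset, Kset, Jset, Set.image_singleton, Set.mem_singleton_iff]; omega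
  have h1 : s ∈ Iset 1 ↔ -s = 4 := by
    simp only [Iset, Kset, Jset, Set.image_singleton, Set.mem_singleton_iff]; omega
  have h2 : s ∈ Iset 2 ↔ -s = 6 := by
    have hK : Kset 2 = {3} := by
      ext a
      simp only [Kset, Jset, Set.image_singleton, Set.mem_sdiff, Set.mem_union, Set.mem_Icc,
        Set.mem_singleton_iff]
      omega
    simp only [Iset, hK, Set.image_singleton, Set.mem_singleton_iff]; omega
  simp only [Sset, Set.mem_iUnion, InNegSset]
  constructor
  · rintro ⟨n, hn⟩
    match n, hn with
    | 0, hn => exact Or.inl (h0.1 hn)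
    | 1, hn => exact Or.inr (Or.inl (h1.1 hn))
    | 2, hn => exact Or.inr (Or.inr (Or.inl (h2.1 hn)))
    | n + 3, hn =>
      refine Or.inr (Or.inr (Or.inr ⟨2 ^ (n + 3), ⟨_, rfl⟩, ?_, (mem_Iset_add_three_iff n s).1 hn⟩))
      calc (8 : ℤ) = 2 ^ 3 := by norm_num
        _ ≤ 2 ^ (n + 3) := pow_le_pow_right₀ (by norm_num) (by omega)
  · rintro (h | h | h | ⟨_, ⟨n, rfl⟩, h8, h⟩)
    · exact ⟨0, h0.2 h⟩
    · exact ⟨1, h1.2 h⟩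
    · exact ⟨2, h2.2 h⟩
    · match n, h8, h with
      | 0, h8, h => norm_num at h8
      | 1, h8, h => norm_num at h8
      | 2, h8, h => norm_num at h8
      | n + 3, h8, h => exact ⟨n + 3, (mem_Iset_add_three_iff n s).2 h⟩

theorem InUpperQuarter.two_le {y : ℤ} (h : InUpperQuarter y) : 2 ≤ y := by
  obtain ⟨B, -, h1, h2, h3⟩ := h
  omega

/-- The only representation of `-(2B + y)` in `S + 𝒯` uses the summand `2B`. -/
theorem eq_two_mul_of_inNegSset {B y p : ℤ} (hB : B ∈ Tset) (hB2 : 2 ≤ B) (h1 : 3 * B < 4 * y)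
    (h2 : y ≤ B) (hp : p ∈ Tset) (h : InNegSset (p + (2 * B + y))) : p = 2 * B := by
  have hp1 := one_le_of_mem_Tset hp
  have hB' := two_mul_mem_Tset hB
  have hB'' := two_mul_mem_Tset hB'
  rcases h with h | h | h | ⟨N, hN, hN8, h⟩
  · omega
  · omega
  · omega
  rcases Tset_trichotomy hp hB' with hpB | hpB | hpB
  · exfalso
    have hNB : N = 2 * B := by
      rcases h with ⟨⟨C, hC, hC'⟩, h⟩ | h <;>
        rcases Tset_trichotomy hN hB' with h' | h' | h' <;> omega
    rcases h with ⟨⟨C, hC, hC'⟩, h⟩ | h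
    · omega
    · rcases Tset_trichotomy hp hB with h' | h' | h' <;> omega
  · exact hpB
  · exfalso
    have hNp : N = p := by
      rcases h with ⟨h0, h⟩ | h
      · have := h0.two_le
        rcases Tset_trichotomy hN hp with h' | h' | h' <;> omega
      · rcases Tset_trichotomy hN hp with h' | h' | h' <;> omega
    subst hNp
    rcases h with ⟨⟨C, hC, hC2, hC'⟩, h⟩ | h
    · rcases Tset_trichotomy hC hB'' with h' | h' | h' <;> omega
    · omega

theorem eq_one_of_inNegSset_add_one {p : ℤ} (hp : p ∈ Tset) (h : InNegSset (p + 1)) : p = 1 := by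
  have hp1 := one_le_of_mem_Tset hp
  have T1 : (1 : ℤ) ∈ Tset := ⟨0, by norm_num⟩
  have T2 := two_mul_mem_Tset T1
  have T4 := two_mul_mem_Tset T2
  rcases h with h | h | h | ⟨N, hN, hN8, h⟩
  · omega
  · rcases Tset_trichotomy hp T2 with h' | h' | h' <;> omega
  · rcases Tset_trichotomy hp T4 with h' | h' | h' <;> omega
  · rcases h with ⟨h0, h⟩ | h
    · have := h0.two_le
      rcases Tset_trichotomy hN hp with h' | h' | h' <;> omega
    · rcases Tset_trichotomy hN hp with h' | h' | h' <;> omega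

theorem eq_two_of_inNegSset_add_thirtySeven {p : ℤ} (hp : p ∈ Tset) (h : InNegSset (p + 37)) :
    p = 2 := by
  have hp1 := one_le_of_mem_Tset hp
  have T4 : (4 : ℤ) ∈ Tset := ⟨2, by norm_num⟩
  have T8 := two_mul_mem_Tset T4
  have T16 := two_mul_mem_Tset T8
  have T32 := two_mul_mem_Tset T16
  have T64 := two_mul_mem_Tset T32
  norm_num at T8 T16 T32 T64
  rcases h with h | h | h | ⟨N, hN, hN8, h⟩
  · omega
  · omega
  · omega
  have hy : 2 ≤ p + 37 - N := by
    rcases h with ⟨h0, h⟩ | h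
    · exact h0.two_le
    · omega
  rcases Tset_trichotomy hp T32 with hp' | rfl | hp'
  · have hN32 : N = 32 := by
      rcases h with h | h <;> rcases Tset_trichotomy hN T32 with h' | h' | h' <;> omega
    subst hN32
    rcases h with ⟨⟨C, hC, hC2, hC'⟩, h⟩ | h
    · rcases Tset_trichotomy hp T4 with h4 | h4 | h4 <;>
        rcases Tset_trichotomy hC T4 with h' | h' | h' <;>
        rcases Tset_trichotomy hC T8 with h' | h' | h' <;> omega
    · rcases Tset_trichotomy hp T16 with h' | h' | h' <;> omega
  · have hN64 : N = 64 := by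
      rcases h with h | h <;> rcases Tset_trichotomy hN T64 with h' | h' | h' <;> omega
    subst hN64
    rcases h with ⟨⟨C, hC, hC2, hC'⟩, h⟩ | h
    · rcases Tset_trichotomy hC T4 with h' | h' | h' <;> omega
    · omega
  · have hNp : N = p := by
      rcases h with h | h <;> rcases Tset_trichotomy hN hp with h' | h' | h' <;> omega
    subst hNp
    rcases h with ⟨⟨C, hC, hC2, hC'⟩, h⟩ | h
    · rcases Tset_trichotomy hC T32 with h' | h' | h' <;> omega
    · omega

theorem add_Tset_eq_univ_iff (A : Set ℤ) :
    A + Tset = Set.univ ↔ ∀ z, ∃ p ∈ Tset, z - p ∈ A := by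
  rw [Set.eq_univ_iff_forall]
  refine forall_congr' fun z => ?_
  rw [Set.mem_add]
  constructor
  · rintro ⟨a, ha, p, hp, rfl⟩
    exact ⟨p, hp, by simpa using ha⟩
  · rintro ⟨p, hp, h⟩
    exact ⟨_, h, p, hp, by ring⟩

theorem exists_inNegSset_sub {z : ℤ} (hz : 0 ≤ z) : ∃ p ∈ Tset, InNegSset (p - z) := by
  rcases hz.eq_or_lt with rfl | hz
  · exact ⟨2, ⟨1, by norm_num⟩, Or.inl (by norm_num)⟩
  · obtain ⟨L, hL, h1, h2⟩ := exists_Tset_Ioc (y := z + 1) (by omega)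
    obtain ⟨M, hM, rfl⟩ := half_mem_Tset hL (by omega)
    have h8 := two_mul_mem_Tset (two_mul_mem_Tset (two_mul_mem_Tset hM))
    have := one_le_of_mem_Tset hM
    refine ⟨_, two_mul_mem_Tset h8, Or.inr (Or.inr (Or.inr ⟨_, h8, by omega, Or.inr ?_⟩))⟩
    omega

theorem exists_inNegSset_add {y : ℤ} (hy : 1 ≤ y) : ∃ p ∈ Tset, InNegSset (p + y) := by
  have T1 : (1 : ℤ) ∈ Tset := ⟨0, by norm_num⟩
  have T2 := two_mul_mem_Tset T1
  have T4 := two_mul_mem_Tset T2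
  obtain ⟨B, hB, h1, h2⟩ := exists_Tset_Ioc hy
  rcases hy.eq_or_lt with rfl | hy2
  · exact ⟨1, T1, Or.inl (by norm_num)⟩
  by_cases hyB : 3 * B < 4 * y
  · refine ⟨_, two_mul_mem_Tset (two_mul_mem_Tset hB), Or.inr (Or.inr (Or.inr ⟨_,
      two_mul_mem_Tset (two_mul_mem_Tset hB), by omega, Or.inl ⟨⟨B, hB, ?_⟩, ?_⟩⟩))⟩ <;> omega
  obtain ⟨H, hH, rfl⟩ := half_mem_Tset hB (by omega)
  obtain ⟨C, hC, h3, h4⟩ := exists_Tset_Ioc (y := y - H) (by omega)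
  have hH1 := one_le_of_mem_Tset hH
  have hC1 := one_le_of_mem_Tset hC
  have hCH : 2 * C ≤ H := by
    rcases Tset_trichotomy hC hH with h | h | h <;> omega
  by_cases hw : y - H = 1
  · refine ⟨1, T1, ?_⟩
    by_cases h8 : 8 ≤ H
    · exact Or.inr (Or.inr (Or.inr ⟨H, hH, h8, Or.inl ⟨⟨2, T2, by omega⟩, by omega⟩⟩))
    · rcases Tset_trichotomy hH T4 with h | h | h
      · exact Or.inr (Or.inl (by omega))
      · exact Or.inr (Or.inr (Or.inl (by omega)))
      · omega
  by_cases hwC : 3 * C < 4 * (y - H)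
  · refine ⟨H, hH, Or.inr (Or.inr (Or.inr ⟨2 * H, hB, ?_, Or.inl ⟨⟨C, hC, ?_⟩, ?_⟩⟩))⟩ <;> omega
  obtain ⟨D, hD, rfl⟩ := half_mem_Tset hC (by omega)
  obtain ⟨E, hE, rfl⟩ := half_mem_Tset hD (by omega)
  rcases Tset_trichotomy hC hH with h | h | h
  · by_cases h' : 4 * (2 * (2 * E)) ≤ H
    · refine ⟨E, hE, Or.inr (Or.inr (Or.inr ⟨H, hH, ?_, Or.inl ⟨⟨_, hC, ?_⟩, ?_⟩⟩))⟩ <;> omega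
    · have hCH' : H = 2 * (2 * (2 * E)) := by
        rcases Tset_trichotomy hH (two_mul_mem_Tset hC) with h | h | h <;> omega
      refine ⟨_, hC, Or.inr (Or.inr (Or.inr ⟨H, hH, ?_, Or.inr ?_⟩))⟩ <;> omega
  · omega
  · omega

theorem Sset_add_Tset : Sset + Tset = Set.univ := by
  rw [add_Tset_eq_univ_iff]
  intro z
  rcases le_or_gt 0 z with hz | hz
  · obtain ⟨p, hp, h⟩ := exists_inNegSset_sub hz
    exact ⟨p, hp, by rwa [mem_Sset_iff, neg_sub]⟩
  · obtain ⟨p, hp, h⟩ := exists_inNegSset_add (y := -z) (by omega)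
    exact ⟨p, hp, by rwa [mem_Sset_iff, neg_sub, sub_eq_add_neg]⟩

theorem le_of_inNegSset_sub {z p : ℤ} (hz : ¬ InUpperQuarter (-z)) (hp : p ∈ Tset)
    (h : InNegSset (p - z)) : p ≤ 16 * |z| + 16 := by
  by_contra! hlt
  have hz1 := le_abs_self z
  have hz2 := neg_le_abs z
  rcases h with h | h | h | ⟨N, hN, hN8, h⟩
  · omega
  · omega
  · omega
  have hy : 0 < p - z - N := by
    rcases h with ⟨h0, h⟩ | h
    · have := h0.two_le
      omega
    · omega
  rcases Tset_trichotomy hN hp with h' | h' | h'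
  · rcases h with h | h <;> omega
  · subst h'
    rcases h with ⟨h0, h⟩ | h
    · exact hz (by simpa using h0)
    · omega
  · omega

theorem exists_uniquely_represented {t : ℤ} (ht : t ∈ Tset) :
    ∃ z, ∀ p ∈ Tset, z - p ∈ Sset → p = t := by
  by_cases h4 : 4 ≤ t
  · obtain ⟨B, hB, rfl⟩ := half_mem_Tset ht (by omega)
    refine ⟨-(2 * B + B), fun p hp h => ?_⟩
    rw [mem_Sset_iff] at h
    refine eq_two_mul_of_inNegSset (y := B) hB (by omega) (by omega) le_rfl hp ?_
    convert h using 1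
    ring
  · have ht1 := one_le_of_mem_Tset ht
    rcases Tset_trichotomy ht ⟨1, rfl⟩ with h' | h' | h'
    · obtain rfl : t = 1 := by omega
      refine ⟨-1, fun p hp h => eq_one_of_inNegSset_add_one hp ?_⟩
      rw [mem_Sset_iff] at h
      convert h using 1
      ring
    · obtain rfl : t = 2 := by omega
      refine ⟨-37, fun p hp h => eq_two_of_inNegSset_add_thirtySeven hp ?_⟩
      rw [mem_Sset_iff] at h
      convert h using 1
      ring
    · omega

/-- If every term of a decreasing sequence of subsets of `S` is an additive complement of `𝒯`,
then so is their intersection. -/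
theorem iInter_add_Tset {A : ℕ → Set ℤ} (hA : Antitone A) (hS : ∀ i, A i ⊆ Sset)
    (h : ∀ i, A i + Tset = Set.univ) : (⋂ i, A i) + Tset = Set.univ := by
  simp only [add_Tset_eq_univ_iff, Set.mem_iInter] at h ⊢
  intro z
  by_cases hz : InUpperQuarter (-z)
  · obtain ⟨B, hB, h2, h3, h4⟩ := hz
    refine ⟨_, two_mul_mem_Tset (two_mul_mem_Tset hB), fun i => ?_⟩
    obtain ⟨p, hp, hpi⟩ := h i (-(2 * B + -z))
    have hpS := (mem_Sset_iff _).1 (hS i hpi)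
    have : p = 2 * B := eq_two_mul_of_inNegSset hB h2 h3 h4 hp (by convert hpS using 1; ring)
    convert hpi using 1
    rw [this]
    ring
  · by_contra! hcon
    choose! f hf using hcon
    obtain ⟨p, hp, hpi⟩ := h ((Finset.Icc 1 (16 * |z| + 16)).sup f) z
    have hle := le_of_inNegSset_sub hz hp (by
      have := (mem_Sset_iff _).1 (hS _ hpi)
      rwa [neg_sub] at this)
    have hmem : p ∈ Finset.Icc 1 (16 * |z| + 16) := Finset.mem_Icc.2 ⟨one_le_of_mem_Tset hp, hle⟩
    exact hf p hp (hA (Finset.le_sup hmem) hpi)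

/-- Writing `S = {−x 0, −x 1, −x 2, ...}` with `x` strictly increasing, define
`Sseq 0 = S` and `Sseq (i+1) = Sseq i \ {−x i}` if this is still an additive complement of
`𝒯`, and `Sseq (i+1) = Sseq i` otherwise. Then `(⋂ i, Sseq i, 𝒯)` is a co-minimal pair. -/
theorem inter_Sseq_Tset_coMinimalPair (x : ℕ → ℤ) (hx : StrictMono x)
    (hSx : Sset = Set.range fun i => -x i)
    (Sseq : ℕ → Set ℤ) (hS0 : Sseq 0 = Sset)
    (hSstep : ∀ i : ℕ,
      ((Sseq i \ {-x i}) + Tset = Set.univ ∧ Sseq (i + 1) = Sseq i \ {-x i}) ∨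
      ((Sseq i \ {-x i}) + Tset ≠ Set.univ ∧ Sseq (i + 1) = Sseq i)) :
    IsCoMinimalPair (⋂ i, Sseq i) Tset := by
  have hstep_sub : ∀ i, Sseq (i + 1) ⊆ Sseq i := fun i => by
    rcases hSstep i with ⟨-, h⟩ | ⟨-, h⟩
    · exact h ▸ Set.sdiff_subset
    · exact h.le
  have hanti : Antitone Sseq := antitone_nat_of_succ_le hstep_sub
  have hsub : ∀ i, Sseq i ⊆ Sset := fun i => hS0 ▸ hanti (Nat.zero_le i)
  have hcov : ∀ i, Sseq i + Tset = Set.univ := by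
    intro i
    induction i with
    | zero => rw [hS0, Sset_add_Tset]
    | succ i ih =>
      rcases hSstep i with ⟨h, h'⟩ | ⟨-, h'⟩
      · rw [h', h]
      · rw [h', ih]
  have hinter := iInter_add_Tset hanti hsub hcov
  refine ⟨?_, ⟨1, 0, by norm_num⟩, hinter, ?_, ?_⟩
  · obtain ⟨a, ha, -⟩ := Set.mem_add.1 (hinter ▸ Set.mem_univ (0 : ℤ))
    exact ⟨a, ha⟩
  · intro A' _ hA' hA'T
    obtain ⟨a, ha, haA'⟩ := Set.exists_of_ssubset hA'
    rw [Set.mem_iInter] at ha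
    obtain ⟨i, rfl⟩ : a ∈ Set.range fun i => -x i := hSx ▸ hsub 0 (ha 0)
    rcases hSstep i with ⟨-, h'⟩ | ⟨h, -⟩
    · have := ha (i + 1)
      rw [h'] at this
      exact this.2 rfl
    · refine h (Set.univ_subset_iff.1 (hA'T ▸ Set.add_subset_add_right fun b hb => ⟨?_, ?_⟩))
      · exact Set.mem_iInter.1 (hA'.1 hb) i
      · rintro rfl
        exact haA' hb
  · intro B' _ hB' hB'T
    obtain ⟨t, ht, htB'⟩ := Set.exists_of_ssubset hB'
    obtain ⟨z, hz⟩ := exists_uniquely_represented ht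
    obtain ⟨a, ha, p, hp, rfl⟩ := Set.mem_add.1 (hB'T ▸ Set.mem_univ z)
    refine htB' (hz p (hB'.1 hp) ?_ ▸ hp)
    simpa using hsub 0 (Set.mem_iInter.1 ha 0)
end

section
/- The set S is not a minimal complement of 𝒯: the proper subset S \ { −2^{2n+1} − 7 : n ≥ 3 } (where −2^{2n+1} − 7 = 2^{2n} + 2^{2n−1} + ⋯ + 2^4 + 2^3 + 2 − (1 + 2^{2n+2}) is an element of S for each n ≥ 3) still satisfies (S \ { −2^{2n+1} − 7 : n ≥ 3 }) + 𝒯 = ℤ. -/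
open scoped Pointwise

theorem sub_mem_Jset {m i : ℕ} {v : ℤ} (hm : i + 2 ≤ m) (h₁ : 3 * 2 ^ i ≤ v)
    (h₂ : v < 4 * 2 ^ i) : 2 ^ m - v ∈ Jset m := by
  induction m with
  | zero => omega
  | succ m ih =>
    obtain ⟨m, rfl⟩ : ∃ k, m = k + 1 := ⟨m - 1, by omega⟩
    rcases Nat.lt_or_ge i m with h | h
    · refine Or.inr ⟨2 ^ (m + 1) - v, ih (by omega), ?_⟩
      simp only
      ring
    · obtain rfl : i = m := by omega
      refine Or.inl ⟨?_, ?_⟩ <;> rw [pow_succ, pow_succ] <;> linarith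

theorem two_pow_sub_one_mem_Jset (m : ℕ) : 2 ^ (m + 1) - 1 ∈ Jset (m + 1) := by
  induction m with
  | zero => simp [Jset]
  | succ m ih =>
    refine Or.inr ⟨_, ih, ?_⟩
    simp only
    ring

theorem neg_sub_one_mem_Sset_of_mem_Ico {n : ℕ} {w : ℤ} (h₁ : 14 * 2 ^ n ≤ w)
    (h₂ : w < 15 * 2 ^ n) : -w - 1 ∈ Sset := by
  refine Set.mem_iUnion.2 ⟨n + 3, 2 ^ (n + 4) - w, Or.inl ⟨?_, ?_⟩, ?_⟩
  · rw [pow_add]; linarith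
  · rw [pow_add, pow_add]; linarith
  · simp only; ring

theorem neg_two_pow_add_mem_Sset_of_mem_Jset {n : ℕ} {v : ℤ}
    (h : 2 ^ (n + 1) - v ∈ Jset (n + 1)) : -(2 ^ (n + 3) + v) - 1 ∈ Sset := by
  refine Set.mem_iUnion.2 ⟨n + 3, _, Or.inr ⟨_, h, rfl⟩, ?_⟩
  simp only
  ring

theorem neg_two_pow_add_mem_Sset {i j : ℕ} {v : ℤ} (hj : i + 4 ≤ j) (h₁ : 3 * 2 ^ i ≤ v)
    (h₂ : v < 4 * 2 ^ i) : -(2 ^ j + v) - 1 ∈ Sset := by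
  obtain ⟨n, rfl⟩ : ∃ n, j = n + 3 := ⟨j - 3, by omega⟩
  exact neg_two_pow_add_mem_Sset_of_mem_Jset (sub_mem_Jset (by omega) h₁ h₂)

theorem neg_two_pow_add_one_mem_Sset (j : ℕ) : -(2 ^ (j + 1) + 1 : ℤ) - 1 ∈ Sset := by
  match j with
  | 0 => exact Set.mem_iUnion.2 ⟨1, 1, by simp [Kset, Jset], by norm_num⟩
  | 1 => exact Set.mem_iUnion.2 ⟨2, 3, by simp [Kset, Jset], by norm_num⟩
  | j + 2 => exact neg_two_pow_add_mem_Sset_of_mem_Jset (two_pow_sub_one_mem_Jset j)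

theorem neg_two_mem_Sset : (-2 : ℤ) ∈ Sset :=
  Set.mem_iUnion.2 ⟨0, 1, by simp [Kset, Jset], by norm_num⟩

/-- The elements removed from `S`. -/
abbrev removedSet : Set ℤ := {z : ℤ | ∃ n : ℕ, 3 ≤ n ∧ z = -(2 : ℤ) ^ (2 * n + 1) - 7}

theorem eq_of_two_pow_add_eq {a b : ℕ} {x y : ℤ} (hx : 0 ≤ x) (hxa : x < 2 ^ a) (hy : 0 ≤ y)
    (hyb : y < 2 ^ b) (h : 2 ^ a + x = 2 ^ b + y) : a = b ∧ x = y := by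
  have hab : a = b := by
    apply le_antisymm <;> by_contra! hlt
    · have := pow_le_pow_right₀ (one_le_two (α := ℤ)) (Nat.succ_le_of_lt hlt)
      rw [Nat.succ_eq_add_one, pow_succ] at this
      linarith
    · have := pow_le_pow_right₀ (one_le_two (α := ℤ)) (Nat.succ_le_of_lt hlt)
      rw [Nat.succ_eq_add_one, pow_succ] at this
      linarith
  subst hab
  exact ⟨rfl, by linarith⟩

theorem eq_of_neg_two_pow_add_mem_removedSet {j : ℕ} {v : ℤ} (hv : 0 ≤ v) (hvj : v < 2 ^ j)
    (h : -(2 ^ j + v) - 1 ∈ removedSet) : ∃ n : ℕ, 3 ≤ n ∧ j = 2 * n + 1 ∧ v = 6 := by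
  obtain ⟨n, hn, h⟩ := h
  have h7 := pow_le_pow_right₀ (one_le_two (α := ℤ)) (show 3 ≤ 2 * n + 1 by omega)
  obtain ⟨h₁, h₂⟩ := eq_of_two_pow_add_eq (b := 2 * n + 1) (y := 6) hv hvj (by norm_num)
    (by linarith) (by linarith)
  exact ⟨n, hn, h₁, h₂⟩

theorem neg_sub_one_notMem_removedSet_of_mem_Ico {k : ℕ} {w : ℤ} (h₁ : 14 * 2 ^ k ≤ w)
    (h₂ : w < 15 * 2 ^ k) : -w - 1 ∉ removedSet := by
  intro h
  have hk : (1 : ℤ) ≤ 2 ^ k := one_le_pow₀ one_le_two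
  have e : (2 : ℤ) ^ (k + 3) = 8 * 2 ^ k := by ring
  rw [show w = 2 ^ (k + 3) + (w - 2 ^ (k + 3)) by ring] at h
  obtain ⟨n, hn, hkn, h6⟩ := eq_of_neg_two_pow_add_mem_removedSet (by linarith) (by linarith) h
  have := pow_le_pow_right₀ (one_le_two (α := ℤ)) (show 1 ≤ k by omega)
  linarith

/-- The integers `u` for which `-u - 1` is a sum of an unremoved element of `S` and a power of
two. -/
def IsCovered (u : ℤ) : Prop := ∃ j : ℕ, -(u + 2 ^ j) - 1 ∈ Sset \ removedSet

theorem isCovered_of_add_mem_Ico {u : ℤ} (j k : ℕ) (h₁ : 14 * 2 ^ k ≤ u + 2 ^ j)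
    (h₂ : u + 2 ^ j < 15 * 2 ^ k) : IsCovered u :=
  ⟨j, neg_sub_one_mem_Sset_of_mem_Ico h₁ h₂, neg_sub_one_notMem_removedSet_of_mem_Ico h₁ h₂⟩

theorem isCovered_of_add_eq_two_pow_add {u : ℤ} (a i j : ℕ) {v : ℤ} (h : u + 2 ^ a = 2 ^ j + v)
    (hj : i + 4 ≤ j) (h₁ : 3 * 2 ^ i ≤ v) (h₂ : v < 4 * 2 ^ i)
    (hr : ∀ n : ℕ, 3 ≤ n → j = 2 * n + 1 → v ≠ 6) : IsCovered u := by
  refine ⟨a, ?_, ?_⟩ <;> rw [h]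
  · exact neg_two_pow_add_mem_Sset hj h₁ h₂
  · intro hmem
    have hi : (1 : ℤ) ≤ 2 ^ i := one_le_pow₀ one_le_two
    have := pow_le_pow_right₀ (one_le_two (α := ℤ)) hj
    rw [pow_add] at this
    obtain ⟨n, hn, hjn, h6⟩ :=
      eq_of_neg_two_pow_add_mem_removedSet (by linarith) (by linarith) hmem
    exact hr n hn hjn h6

theorem isCovered_of_add_eq_two_pow_add_one {u : ℤ} (a j : ℕ)
    (h : u + 2 ^ a = 2 ^ (j + 1) + 1) : IsCovered u := by
  refine ⟨a, ?_, ?_⟩ <;> rw [h]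
  · exact neg_two_pow_add_one_mem_Sset j
  · intro hmem
    have := pow_le_pow_right₀ (one_le_two (α := ℤ)) (show 1 ≤ j + 1 by omega)
    obtain ⟨n, -, -, h6⟩ :=
      eq_of_neg_two_pow_add_mem_removedSet zero_le_one (by linarith) hmem
    norm_num at h6

theorem exists_eq_two_pow_add {u : ℤ} (hu : 0 < u) :
    ∃ (p : ℕ) (r : ℤ), u = 2 ^ p + r ∧ 0 ≤ r ∧ r < 2 ^ p := by
  lift u to ℕ using hu.le
  have hu' : u ≠ 0 := by
    rintro rfl
    exact lt_irrefl _ hu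
  have h₁ : ((2 ^ Nat.log 2 u : ℕ) : ℤ) ≤ u := by exact_mod_cast Nat.pow_log_le_self 2 hu'
  have h₂ : (u : ℤ) < ((2 ^ (Nat.log 2 u + 1) : ℕ) : ℤ) := by
    exact_mod_cast Nat.lt_pow_succ_log_self one_lt_two u
  push_cast at h₁ h₂
  rw [pow_succ] at h₂
  exact ⟨Nat.log 2 u, u - 2 ^ Nat.log 2 u, by ring, by linarith, by linarith⟩

theorem lt_of_two_pow_lt_two_pow {a b : ℕ} (h : (2 : ℤ) ^ a < 2 ^ b) : a < b :=
  (pow_lt_pow_iff_right₀ one_lt_two).1 h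

theorem isCovered_zero : IsCovered 0 := by
  refine ⟨0, by simpa using neg_two_mem_Sset, ?_⟩
  rintro ⟨n, -, h⟩
  have : (0 : ℤ) < 2 ^ (2 * n + 1) := by positivity
  linarith

theorem isCovered_of_neg {u : ℤ} (hu : u < 0) : IsCovered u := by
  rcases eq_or_lt_of_le (show u ≤ -1 by omega) with rfl | hu
  · exact isCovered_of_add_eq_two_pow_add_one 2 0 (by norm_num)
  · obtain ⟨p, r, h, hr, hrp⟩ := exists_eq_two_pow_add (u := -u - 1) (by omega)
    refine isCovered_of_add_mem_Ico (p + 4) p ?_ ?_ <;> rw [pow_add] <;> linarith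

theorem isCovered_of_pos {u : ℤ} (hu : 0 < u) : IsCovered u := by
  obtain ⟨p, r, rfl, hr, hrp⟩ := exists_eq_two_pow_add hu
  rcases hr.eq_or_lt with rfl | hr
  · rcases p with _ | p
    · exact isCovered_of_add_eq_two_pow_add_one 1 0 (by norm_num)
    · exact isCovered_of_add_eq_two_pow_add_one 0 p (by ring)
  obtain ⟨q, t, rfl, ht, htq⟩ := exists_eq_two_pow_add hr
  have hqp : q < p := lt_of_two_pow_lt_two_pow (by linarith)
  rcases Nat.lt_or_ge (q + 1) p with hqp₂ | hqp₂
  swap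
  · obtain rfl : p = q + 1 := by omega
    refine isCovered_of_add_eq_two_pow_add (2 * q + 4) q (2 * q + 4) (add_comm _ _) (by omega)
      ?_ ?_ (fun n _ h => by omega) <;> rw [pow_succ] <;> linarith
  rcases q with _ | q
  · obtain rfl : t = 0 := by rw [pow_zero] at htq; omega
    exact isCovered_of_add_eq_two_pow_add_one p p (by ring)
  have hq : (1 : ℤ) ≤ 2 ^ q := one_le_pow₀ one_le_two
  have e : (2 : ℤ) ^ (q + 1) = 2 * 2 ^ q := by ring
  rw [e] at htq ⊢
  rcases le_or_gt (2 ^ q) t with hqt | hqt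
  · by_cases hbad : ∃ n : ℕ, 3 ≤ n ∧ p + 1 = 2 * n + 1 ∧ 2 * 2 ^ q + t = 6
    · obtain ⟨n, hn, hpn, h6⟩ := hbad
      rw [h6]
      exact isCovered_of_add_eq_two_pow_add 0 1 p (v := 7) (by ring) (by omega) (by norm_num)
        (by norm_num) (fun _ _ _ => by norm_num)
    · exact isCovered_of_add_eq_two_pow_add p q (p + 1) (v := 2 * 2 ^ q + t) (by ring)
        (by omega) (by linarith) (by linarith) fun n hn hpn h6 => hbad ⟨n, hn, hpn, h6⟩
  rcases Nat.lt_or_ge (q + 3) p with hqp₃ | hqp₃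
  · by_cases hbad : ∃ n : ℕ, 3 ≤ n ∧ p = 2 * n + 1 ∧ 3 * 2 ^ q + t = 6
    · obtain ⟨n, hn, hpn, h6⟩ := hbad
      have hq1 : q = 1 := by
        have h₁ := lt_of_two_pow_lt_two_pow (a := q) (b := 2) (by linarith)
        rcases q with _ | q
        · rw [pow_zero] at h6 hqt; omega
        · omega
      subst hq1
      obtain rfl : t = 0 := by linarith
      exact isCovered_of_add_eq_two_pow_add 3 2 p (v := 12) (by ring) (by omega) (by norm_num)
        (by norm_num) (fun _ _ _ => by norm_num)
    · exact isCovered_of_add_eq_two_pow_add q q p (v := 3 * 2 ^ q + t) (by ring)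
        (by omega) (by linarith) (by linarith) fun n hn hpn h6 => hbad ⟨n, hn, hpn, h6⟩
  · obtain rfl : p = q + 3 := by omega
    refine isCovered_of_add_mem_Ico (q + 2) q ?_ ?_ <;> rw [pow_add, pow_add] <;> linarith

/-- `S` is not a minimal complement of `𝒯`: each `−2^(2n+1) − 7` (for `n ≥ 3`) lies in
`S`, so removing them gives a proper subset of `S`, and this proper subset is still an
additive complement of `𝒯`. -/
theorem Sset_not_minimal_complement :
    (∀ n : ℕ, 3 ≤ n → (-(2 : ℤ) ^ (2 * n + 1) - 7) ∈ Sset) ∧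
    (Sset \ {z : ℤ | ∃ n : ℕ, 3 ≤ n ∧ z = -(2 : ℤ) ^ (2 * n + 1) - 7}) ⊂ Sset ∧
    (Sset \ {z : ℤ | ∃ n : ℕ, 3 ≤ n ∧ z = -(2 : ℤ) ^ (2 * n + 1) - 7}) + Tset = Set.univ := by
  have hmem : ∀ n : ℕ, 3 ≤ n → (-(2 : ℤ) ^ (2 * n + 1) - 7) ∈ Sset := fun n hn => by
    have := neg_two_pow_add_mem_Sset (i := 1) (j := 2 * n + 1) (v := 6) (by omega)
      (by norm_num) (by norm_num)
    rwa [show -((2 : ℤ) ^ (2 * n + 1) + 6) - 1 = -2 ^ (2 * n + 1) - 7 by ring] at this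
  refine ⟨hmem, ⟨Set.sdiff_subset, fun h => ?_⟩, Set.eq_univ_of_forall fun x => ?_⟩
  · exact (h (hmem 3 le_rfl)).2 ⟨3, le_rfl, rfl⟩
  · obtain ⟨j, hj⟩ : IsCovered (-x - 1) := by
      rcases lt_trichotomy (-x - 1) 0 with h | h | h
      · exact isCovered_of_neg h
      · exact h ▸ isCovered_zero
      · exact isCovered_of_pos h
    exact Set.mem_add.2 ⟨_, hj, 2 ^ j, ⟨j, rfl⟩, by ring⟩
end

section
/- 𝒱 is a minimal complement of U in ℤ: U + 𝒱 = ℤ, and U + 𝒱' ≠ ℤ for every nonempty proper subset 𝒱' ⊊ 𝒱. Equivalently, every nonempty subset 𝒱' ⊆ 𝒱 with U + 𝒱' = ℤ satisfies 𝒱' = 𝒱. -/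
open scoped Pointwise

/-- `𝒱 = {2^n : n ≥ 0} ∪ {−2^n : n ≥ 0}`. -/
def Vset : Set ℤ := {x | ∃ n : ℕ, x = 2 ^ n ∨ x = -(2 ^ n)}

/-- The sets `U_n`: `U_0 = {−2, −1}`, `U_1 = U_2 = ∅`, `U_3 = {6} − (1 + 2^4)`,
`U_4 = {3, 4, 14} − (1 + 2^5)`, and for `n ≥ 5`,
`U_n = ((2^(n−3) + {1, ..., 2^(n−3)}) ∪ (2^(n−1) + 2^(n−2) + {1, ..., 2^(n−4)})) − (1 + 2^(n+1))`. -/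
def Useq : ℕ → Set ℤ
  | 0 => {-2, -1}
  | 1 => ∅
  | 2 => ∅
  | 3 => {6 - (1 + 2 ^ 4)}
  | 4 => (fun x => x - (1 + 2 ^ 5)) '' {3, 4, 14}
  | n + 5 => (fun x => x - (1 + 2 ^ (n + 6))) ''
      (Set.Icc ((2 : ℤ) ^ (n + 2) + 1) (2 ^ (n + 2) + 2 ^ (n + 2)) ∪
       Set.Icc ((2 : ℤ) ^ (n + 4) + 2 ^ (n + 3) + 1) (2 ^ (n + 4) + 2 ^ (n + 3) + 2 ^ (n + 1)))

/-- `U = ⋃_{n ≥ 0} U_n`. -/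
def Uset : Set ℤ := ⋃ n, Useq n

/-- A closed form for membership in `Uset`: six sporadic points and two families of intervals. -/
theorem mem_Uset_iff {u : ℤ} : u ∈ Uset ↔
    (u = -2 ∨ u = -1 ∨ u = -11 ∨ u = -30 ∨ u = -29 ∨ u = -19) ∨
      ∃ n : ℕ, (-(60 * 2 ^ n) ≤ u ∧ u < -(56 * 2 ^ n)) ∨ (-(40 * 2 ^ n) ≤ u ∧ u < -(38 * 2 ^ n)) := by
  have mem_add_five : ∀ n : ℕ, u ∈ Useq (n + 5) ↔
      (-(60 * 2 ^ n) ≤ u ∧ u < -(56 * 2 ^ n)) ∨ (-(40 * 2 ^ n) ≤ u ∧ u < -(38 * 2 ^ n)) := by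
    intro n
    simp only [Useq, Set.mem_image, Set.mem_union, Set.mem_Icc, pow_add]
    constructor
    · rintro ⟨x, hx, rfl⟩
      omega
    · intro h
      exact ⟨u + (1 + 2 ^ n * 2 ^ 6), by omega, by ring⟩
  simp only [Uset, Set.mem_iUnion]
  constructor
  · rintro ⟨n, hn⟩
    match n, hn with
    | 0, hn => simp [Useq] at hn; omega
    | 1, hn => simp [Useq] at hn
    | 2, hn => simp [Useq] at hn
    | 3, hn => simp [Useq] at hn; omega
    | 4, hn => simp [Useq] at hn; omega
    | n + 5, hn => exact Or.inr ⟨n, (mem_add_five n).1 hn⟩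
  · rintro ((h | h | h | h | h | h) | ⟨n, hn⟩)
    · exact ⟨0, by simp [Useq, h]⟩
    · exact ⟨0, by simp [Useq, h]⟩
    · exact ⟨3, by simp [Useq, h]⟩
    · exact ⟨4, by simp [Useq, h]⟩
    · exact ⟨4, by simp [Useq, h]⟩
    · exact ⟨4, by simp [Useq, h]⟩
    · exact ⟨n + 5, (mem_add_five n).2 hn⟩

theorem two_pow_mem_Vset (n : ℕ) : (2 : ℤ) ^ n ∈ Vset := ⟨n, Or.inl rfl⟩

theorem neg_two_pow_mem_Vset (n : ℕ) : -(2 : ℤ) ^ n ∈ Vset := ⟨n, Or.inr rfl⟩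

theorem mem_Uset_add_Vset {x v : ℤ} (hv : v ∈ Vset) (hu : x - v ∈ Uset) : x ∈ Uset + Vset :=
  Set.mem_add.2 ⟨x - v, hu, v, hv, by ring⟩

theorem exists_two_pow_le_lt {y : ℤ} (hy : 0 < y) : ∃ m : ℕ, (2 : ℤ) ^ m ≤ y ∧ y < 2 * 2 ^ m := by
  lift y to ℕ using hy.le
  have hy' : y ≠ 0 := by omega
  refine ⟨Nat.log 2 y, ?_, ?_⟩
  · exact_mod_cast Nat.pow_log_le_self 2 hy'
  · have := Nat.lt_pow_succ_log_self one_lt_two y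
    rw [pow_succ'] at this
    exact_mod_cast this

theorem mem_Uset_add_Vset_of_four_le {x : ℤ} (hx : 4 ≤ x) : x ∈ Uset + Vset := by
  obtain ⟨m, hm, hm'⟩ := exists_two_pow_le_lt (y := x) (by omega)
  obtain ⟨n, rfl⟩ : ∃ n, m = n + 2 := by
    refine ⟨m - 2, ?_⟩
    rcases m with _ | _ | m
    · norm_num at hm'; omega
    · norm_num at hm'; omega
    · omega
  refine mem_Uset_add_Vset (two_pow_mem_Vset (n + 6)) (mem_Uset_iff.2 (Or.inr ⟨n, Or.inl ?_⟩))
  rw [pow_add] at *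
  omega

/-- The integers in `[-2^(n+6), -2^(n+5))`, except those within `2^(n+1)` of the right end. -/
theorem mem_Uset_add_Vset_of_le_of_lt {x : ℤ} (n : ℕ) (h : -(64 * 2 ^ n) ≤ x)
    (h' : x < -(34 * 2 ^ n)) : x ∈ Uset + Vset := by
  have hP : (0 : ℤ) < 2 ^ n := by positivity
  by_cases h₁ : x < -(48 * 2 ^ n)
  · refine mem_Uset_add_Vset (two_pow_mem_Vset (n + 8))
      (mem_Uset_iff.2 (Or.inr ⟨n + 3, Or.inr ?_⟩))
    rw [pow_add, pow_add]; omega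
  by_cases h₂ : x < -(44 * 2 ^ n)
  · refine mem_Uset_add_Vset (two_pow_mem_Vset (n + 5))
      (mem_Uset_iff.2 (Or.inr ⟨n + 1, Or.inr ?_⟩))
    rw [pow_add, pow_add]; omega
  by_cases h₃ : x < -(40 * 2 ^ n)
  · refine mem_Uset_add_Vset (two_pow_mem_Vset (n + 4)) (mem_Uset_iff.2 (Or.inr ⟨n, Or.inl ?_⟩))
    rw [pow_add]; omega
  by_cases h₄ : x < -(38 * 2 ^ n) - 1
  · refine mem_Uset_add_Vset (neg_two_pow_mem_Vset 0) (mem_Uset_iff.2 (Or.inr ⟨n, Or.inr ?_⟩))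
    rw [pow_zero]; omega
  by_cases h₅ : x < -(38 * 2 ^ n)
  · refine mem_Uset_add_Vset (two_pow_mem_Vset 0) (mem_Uset_iff.2 (Or.inr ⟨n, Or.inr ?_⟩))
    rw [pow_zero]; omega
  by_cases h₆ : x < -(36 * 2 ^ n)
  · refine mem_Uset_add_Vset (two_pow_mem_Vset (n + 1)) (mem_Uset_iff.2 (Or.inr ⟨n, Or.inr ?_⟩))
    rw [pow_add]; omega
  · refine mem_Uset_add_Vset (two_pow_mem_Vset (n + 2)) (mem_Uset_iff.2 (Or.inr ⟨n, Or.inr ?_⟩))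
    rw [pow_add]; omega

theorem mem_Uset_add_Vset_of_lt {x : ℤ} (hx : x < -34) : x ∈ Uset + Vset := by
  obtain ⟨m, hm, hm'⟩ := exists_two_pow_le_lt (y := -x - 1) (by omega)
  obtain ⟨n, rfl⟩ : ∃ n, m = n + 5 := by
    refine ⟨m - 5, ?_⟩
    by_contra hlt
    have : (2 : ℤ) ^ m ≤ 2 ^ 4 := pow_le_pow_right₀ (by norm_num) (by omega)
    omega
  rw [pow_add] at hm hm'
  by_cases h : x < -(34 * 2 ^ n)
  · exact mem_Uset_add_Vset_of_le_of_lt n (by omega) h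
  rcases n with _ | n
  · norm_num at h; omega
  refine mem_Uset_add_Vset (neg_two_pow_mem_Vset (n + 3)) (mem_Uset_iff.2 (Or.inr ⟨n, Or.inl ?_⟩))
  rw [pow_succ] at *
  rw [pow_add]
  omega

theorem mem_Uset_add_Vset_of_le_of_le {x : ℤ} (h : -34 ≤ x) (h' : x ≤ 3) : x ∈ Uset + Vset := by
  have key : ∀ x ∈ Finset.Icc (-34 : ℤ) 3,
      ∃ u ∈ ([-2, -1, -11, -30, -29, -19, -40, -80] : List ℤ),
        ∃ k ∈ List.range 7, x - 2 ^ k = u ∨ x - -2 ^ k = u := by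
    decide
  obtain ⟨u, hu, k, -, hk⟩ := key x (Finset.mem_Icc.2 ⟨h, h'⟩)
  have hU : u ∈ Uset := by
    rw [mem_Uset_iff]
    simp only [List.mem_cons, List.not_mem_nil, or_false] at hu
    by_cases hs : -30 ≤ u
    · exact Or.inl (by omega)
    by_cases ht : -40 ≤ u
    · exact Or.inr ⟨0, by omega⟩
    · exact Or.inr ⟨1, by omega⟩
  rcases hk with rfl | rfl
  · exact mem_Uset_add_Vset (two_pow_mem_Vset k) hU
  · exact mem_Uset_add_Vset (neg_two_pow_mem_Vset k) hU

theorem Uset_add_Vset : Uset + Vset = Set.univ := by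
  refine Set.eq_univ_of_forall fun x => ?_
  by_cases h : x < -34
  · exact mem_Uset_add_Vset_of_lt h
  by_cases h' : x ≤ 3
  · exact mem_Uset_add_Vset_of_le_of_le (by omega) h'
  · exact mem_Uset_add_Vset_of_four_le (by omega)

/-- Comparison of `2 ^ b` with `C * 2 ^ a`, where `C = 2 ^ c`. -/
theorem two_pow_trichotomy (c a b : ℕ) {C : ℤ} (hC : 2 ^ c = C) :
    2 * (2 : ℤ) ^ b ≤ C * 2 ^ a ∨ (b = c + a ∧ (2 : ℤ) ^ b = C * 2 ^ a) ∨
      2 * C * 2 ^ a ≤ (2 : ℤ) ^ b := by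
  subst hC
  rw [mul_assoc, ← pow_add, ← pow_succ', ← pow_succ']
  rcases lt_trichotomy b (c + a) with h | h | h
  · exact Or.inl (pow_le_pow_right₀ (by norm_num) h)
  · exact Or.inr (Or.inl ⟨h, by rw [h]⟩)
  · exact Or.inr (Or.inr (pow_le_pow_right₀ (by norm_num) h))

/-- The integer `2 ^ k` is represented in `Uset + Vset` only via `2 ^ (k + 4)`. -/
theorem eq_of_two_pow_sub_mem_Uset {k : ℕ} (hk : 2 ≤ k) {v : ℤ} (hv : v ∈ Vset)
    (hu : 2 ^ k - v ∈ Uset) : v = 2 ^ (k + 4) := by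
  obtain ⟨j, hj⟩ := hv
  suffices v = 2 ^ j ∧ j = k + 4 by rw [this.1, this.2]
  have hX : (0 : ℤ) < 2 ^ j := by positivity
  have hK : (4 : ℤ) ≤ 2 ^ k := by
    calc (4 : ℤ) = 2 ^ 2 := by norm_num
      _ ≤ 2 ^ k := pow_le_pow_right₀ (by norm_num) hk
  have hjk := two_pow_trichotomy 0 k j (pow_zero 2)
  rcases mem_Uset_iff.1 hu with hs | ⟨n, hn⟩
  · obtain ⟨r, hr⟩ : (4 : ℤ) ∣ 2 ^ k := pow_dvd_pow 2 hk
    rcases Nat.lt_or_ge j 2 with hlt | hle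
    · interval_cases j <;> omega
    · obtain ⟨s, hs'⟩ : (4 : ℤ) ∣ 2 ^ j := pow_dvd_pow 2 hle
      omega
  · have hP : (0 : ℤ) < 2 ^ n := by positivity
    have h₁ := two_pow_trichotomy 6 n j (C := 64) (by norm_num)
    have h₂ := two_pow_trichotomy 2 n k (C := 4) (by norm_num)
    have h₃ := two_pow_trichotomy 4 n k (C := 16) (by norm_num)
    omega

/-- The integer `-2 ^ (k + 3) - 3` is represented in `Uset + Vset` only via `-2 ^ k`. -/
theorem eq_of_neg_two_pow_sub_mem_Uset {k : ℕ} (hk : 3 ≤ k) {v : ℤ} (hv : v ∈ Vset)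
    (hu : -2 ^ (k + 3) - 3 - v ∈ Uset) : v = -2 ^ k := by
  obtain ⟨j, hj⟩ := hv
  suffices v = -2 ^ j ∧ j = k by rw [this.1, this.2]
  have hX : (0 : ℤ) < 2 ^ j := by positivity
  have hK : (8 : ℤ) ≤ 2 ^ k := by
    calc (8 : ℤ) = 2 ^ 3 := by norm_num
      _ ≤ 2 ^ k := pow_le_pow_right₀ (by norm_num) hk
  rw [pow_add] at hu
  have hjk := two_pow_trichotomy 3 k j (C := 8) (by norm_num)
  rcases mem_Uset_iff.1 hu with hs | ⟨n, hn⟩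
  · omega
  · have hP : (0 : ℤ) < 2 ^ n := by positivity
    have h₁ := two_pow_trichotomy 3 n k (C := 8) (by norm_num)
    have h₂ := two_pow_trichotomy 2 n k (C := 4) (by norm_num)
    have h₃ := two_pow_trichotomy 3 n j (C := 8) (by norm_num)
    have h₄ := two_pow_trichotomy 5 n j (C := 32) (by norm_num)
    have h₅ := two_pow_trichotomy 0 n k (pow_zero 2)
    generalize (2 : ℤ) ^ n = P at *
    generalize (2 : ℤ) ^ k = K at *
    generalize (2 : ℤ) ^ j = X at *
    rcases hj with rfl | rfl <;> rcases hn with hn | hn <;> omega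

theorem mem_Uset_of_gt {u : ℤ} (hu : u ∈ Uset) (h : -608 < u) :
    (u = -2 ∨ u = -1 ∨ u = -11 ∨ u = -30 ∨ u = -29 ∨ u = -19) ∨
      (-40 ≤ u ∧ u < -38) ∨ (-60 ≤ u ∧ u < -56) ∨ (-80 ≤ u ∧ u < -76) ∨
      (-120 ≤ u ∧ u < -112) ∨ (-160 ≤ u ∧ u < -152) ∨ (-240 ≤ u ∧ u < -224) ∨
      (-320 ≤ u ∧ u < -304) ∨ (-480 ≤ u ∧ u < -448) := by
  rcases mem_Uset_iff.1 hu with hs | ⟨n, hn⟩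
  · exact Or.inl hs
  have hn' : n < 4 := by
    by_contra! hle
    have : (2 : ℤ) ^ 4 ≤ 2 ^ n := pow_le_pow_right₀ (by norm_num) hle
    omega
  interval_cases n <;> omega

theorem exponent_lt_of_sub_mem_Uset {w v : ℤ} (hw : -36 ≤ w) (hw' : w ≤ 1) {j : ℕ}
    (hj : v = 2 ^ j ∨ v = -2 ^ j) (hu : w - v ∈ Uset) : j < 10 := by
  by_contra! hle
  have hX : (2 : ℤ) ^ 10 ≤ 2 ^ j := pow_le_pow_right₀ (by norm_num) hle
  rcases mem_Uset_iff.1 hu with hs | ⟨n, hn⟩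
  · omega
  · have hP : (0 : ℤ) < 2 ^ n := by positivity
    have h₁ := two_pow_trichotomy 6 n j (C := 64) (by norm_num)
    omega

/-- Each element `v` of `Vset` is needed to represent some integer. -/
theorem exists_forall_sub_mem_Uset_imp_eq {v : ℤ} (hv : v ∈ Vset) :
    ∃ w : ℤ, ∀ v' ∈ Vset, w - v' ∈ Uset → v' = v := by
  have small : ∀ w : ℤ, -36 ≤ w → w ≤ 1 → ∀ v₀ : ℤ,
      (w = -1 ∧ v₀ = 1 ∨ w = 1 ∧ v₀ = 2 ∨ w = -36 ∧ v₀ = 4 ∨ w = -11 ∧ v₀ = 8 ∨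
        w = -24 ∧ v₀ = 16 ∨ w = -8 ∧ v₀ = 32 ∨ w = -2 ∧ v₀ = -1 ∨ w = -4 ∧ v₀ = -2 ∨
        w = -5 ∧ v₀ = -4) → ∀ v' ∈ Vset, w - v' ∈ Uset → v' = v₀ := by
    rintro w hw hw' v₀ h v' ⟨j, hj⟩ hu
    have hj' := exponent_lt_of_sub_mem_Uset hw hw' hj hu
    have hX : (2 : ℤ) ^ j ≤ 512 := by
      calc (2 : ℤ) ^ j ≤ 2 ^ 9 := pow_le_pow_right₀ (by norm_num) (by omega)
        _ = 512 := by norm_num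
    have hX0 : (0 : ℤ) < 2 ^ j := by positivity
    have hu' := mem_Uset_of_gt hu (by omega)
    clear hu hX hX0
    interval_cases j <;> norm_num at hj <;> rcases hj with rfl | rfl <;> omega
  obtain ⟨k, rfl | rfl⟩ := hv
  · rcases Nat.lt_or_ge k 6 with hk | hk
    · interval_cases k
      · exact ⟨-1, small _ (by norm_num) (by norm_num) _ (by norm_num)⟩
      · exact ⟨1, small _ (by norm_num) (by norm_num) _ (by norm_num)⟩
      · exact ⟨-36, small _ (by norm_num) (by norm_num) _ (by norm_num)⟩
      · exact ⟨-11, small _ (by norm_num) (by norm_num) _ (by norm_num)⟩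
      · exact ⟨-24, small _ (by norm_num) (by norm_num) _ (by norm_num)⟩
      · exact ⟨-8, small _ (by norm_num) (by norm_num) _ (by norm_num)⟩
    · obtain ⟨m, rfl⟩ := Nat.exists_eq_add_of_le' (show 4 ≤ k by omega)
      exact ⟨2 ^ m, fun _ => eq_of_two_pow_sub_mem_Uset (by omega)⟩
  · rcases Nat.lt_or_ge k 3 with hk | hk
    · interval_cases k
      · exact ⟨-2, small _ (by norm_num) (by norm_num) _ (by norm_num)⟩
      · exact ⟨-4, small _ (by norm_num) (by norm_num) _ (by norm_num)⟩
      · exact ⟨-5, small _ (by norm_num) (by norm_num) _ (by norm_num)⟩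
    · exact ⟨-2 ^ (k + 3) - 3, fun _ => eq_of_neg_two_pow_sub_mem_Uset hk⟩

/-- `𝒱` is a minimal complement of `U` in `ℤ`. -/
theorem Vset_minimal_complement_of_Uset :
    Uset + Vset = Set.univ ∧
      ∀ 𝒱' : Set ℤ, 𝒱'.Nonempty → 𝒱' ⊂ Vset → Uset + 𝒱' ≠ Set.univ := by
  refine ⟨Uset_add_Vset, fun 𝒱' _ hss huniv => hss.2 fun v hv => ?_⟩
  obtain ⟨w, hw⟩ := exists_forall_sub_mem_Uset_imp_eq hv
  obtain ⟨u, hu, v', hv', rfl⟩ := Set.mem_add.1 (huniv ▸ Set.mem_univ w)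
  exact hw v' (hss.1 hv') (by rwa [add_sub_cancel_right]) ▸ hv'
end
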